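/- For every n ≥ 4, the toric ideal I_{K_n} of the complete graph on n vertices contains a circuit of degree n − 2. -/

import Mathlib

open MvPolynomial

noncomputable section

/-! ### Term orders, initial terms, (reduced) Gröbner bases, universal Gröbner basis -/

/-- A term order on the monomials (exponent vectors) in variables indexed by `σ`:
a linear order for which `0` is least and which is compatible with addition. -/
structure TermOrder (σ : Type*) where
  lo : LinearOrder (σ →₀ ℕ)
  zero_min : ∀ u : σ →₀ ℕ, lo.le 0 u
  add_right : ∀ u v w : σ →₀ ℕ, lo.le u v → lo.le (u + w) (v + w)

variable {σ : Type*} {K : Type*} [Field K]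

/-- The leading (largest) exponent of a polynomial with respect to a term order
(junk value `0` if `f = 0`). -/
def TermOrder.leadExp (t : TermOrder σ) (f : MvPolynomial σ K) : σ →₀ ℕ :=
  haveI := Classical.propDecidable (f = 0)
  if h : f = 0 then 0
  else @Finset.max' _ t.lo f.support
    (Finset.nonempty_iff_ne_empty.mpr fun he => h (MvPolynomial.support_eq_empty.mp he))

/-- The initial term of a polynomial with respect to a term order. -/
def TermOrder.initial (t : TermOrder σ) (f : MvPolynomial σ K) : MvPolynomial σ K :=
  monomial (t.leadExp f) (f.coeff (t.leadExp f))

/-- `𝒢` is a Gröbner basis of `I` w.r.t. the term order `t`. -/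
def IsGroebnerBasis (t : TermOrder σ) (I : Ideal (MvPolynomial σ K))
    (𝒢 : Finset (MvPolynomial σ K)) : Prop :=
  (𝒢 : Set (MvPolynomial σ K)) ⊆ (I : Set (MvPolynomial σ K)) ∧
    Ideal.span (t.initial '' (𝒢 : Set (MvPolynomial σ K))) =
      Ideal.span (t.initial '' (I : Set (MvPolynomial σ K)))

/-- `𝒢` is a reduced Gröbner basis of `I` w.r.t. `t`: a Gröbner basis, all of whose elements
are monic, and no monomial occurring in an element of `𝒢` is divisible by the initial term of
a different element of `𝒢`. -/
def IsReducedGroebnerBasis (t : TermOrder σ) (I : Ideal (MvPolynomial σ K))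
    (𝒢 : Finset (MvPolynomial σ K)) : Prop :=
  IsGroebnerBasis t I 𝒢 ∧
    (∀ g ∈ 𝒢, g.coeff (t.leadExp g) = 1) ∧
    (∀ g ∈ 𝒢, ∀ g' ∈ 𝒢, g' ≠ g → ∀ u ∈ g.support, ¬ t.leadExp g' ≤ u)

/-- The universal Gröbner basis of `I`: the union of all reduced Gröbner bases of `I`
over all term orders. -/
def UniversalGB (I : Ideal (MvPolynomial σ K)) : Set (MvPolynomial σ K) :=
  {f | ∃ (t : TermOrder σ) (𝒢 : Finset (MvPolynomial σ K)),
    IsReducedGroebnerBasis t I 𝒢 ∧ f ∈ 𝒢}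

/-! ### Binomials, primitive binomials (Graver basis), circuits -/

/-- The binomial `x^u - x^v`. -/
def binom (K : Type*) [Field K] {σ : Type*} (u v : σ →₀ ℕ) : MvPolynomial σ K :=
  monomial u 1 - monomial v 1

/-- `f` is a primitive binomial of `I`: `f = x^u - x^v ∈ I` and there is no other binomial
`x^w - x^z ∈ I` with `x^w ∣ x^u` and `x^z ∣ x^v`.  The set of primitive binomials of `I`
is the Graver basis of `I`. -/
def IsPrimitiveBinomial (I : Ideal (MvPolynomial σ K)) (f : MvPolynomial σ K) : Prop :=
  ∃ u v : σ →₀ ℕ, u ≠ v ∧ f = binom K u v ∧ f ∈ I ∧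
    ∀ w z : σ →₀ ℕ, w ≠ z → binom K w z ∈ I → w ≤ u → z ≤ v → w = u ∧ z = v

/-- `f` is a circuit of `I`: an irreducible binomial of `I` whose support (set of variables
occurring in it) is minimal among the supports of nonzero binomials of `I`. -/
def IsCircuitBinomial (I : Ideal (MvPolynomial σ K)) (f : MvPolynomial σ K) : Prop :=
  (∃ u v : σ →₀ ℕ, u ≠ v ∧ f = binom K u v) ∧ f ∈ I ∧ Irreducible f ∧
    ∀ g : MvPolynomial σ K, (∃ u v : σ →₀ ℕ, u ≠ v ∧ g = binom K u v) → g ∈ I →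
      g.vars ⊆ f.vars → g.vars = f.vars

/-- The toric ideal of a vector configuration `A = (a_1, …, a_m) ⊆ ℕ^n`: the ideal generated
by all binomials `x^u - x^v` with `Σ uᵢ aᵢ = Σ vᵢ aᵢ`. -/
def toricIdealOfConfig (K : Type*) [Field K] {m n : ℕ} (A : Fin m → Fin n → ℕ) :
    Ideal (MvPolynomial (Fin m) K) :=
  Ideal.span {f | ∃ u v : Fin m →₀ ℕ,
    f = binom K u v ∧ (∑ i, u i • A i) = ∑ i, v i • A i}

/-! ### Toric ideals of graphs -/

variable {V : Type*}

/-- The image `x_u * x_v` of an edge `e = {u, v}`. -/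
def edgeImage (K : Type*) [Field K] {V : Type*} (e : Sym2 V) : MvPolynomial V K :=
  Sym2.lift ⟨fun a b => X a * X b, fun a b => mul_comm _ _⟩ e

/-- The toric ideal `I_G` of a graph `G`: the kernel of the `K`-algebra map
`K[e : e ∈ E(G)] → K[x_v : v ∈ V(G)]`, `e = {u,v} ↦ x_u x_v`. -/
def graphToricIdeal (K : Type*) [Field K] (G : SimpleGraph V) :
    Ideal (MvPolynomial G.edgeSet K) :=
  RingHom.ker (MvPolynomial.aeval
    (fun e : G.edgeSet => edgeImage K (e : Sym2 V)) :
      MvPolynomial G.edgeSet K →ₐ[K] MvPolynomial V K).toRingHom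

/-- An even closed walk `(v_0, v_1, …, v_{2q} = v_0)` in a graph `G`;
edges and vertices may repeat. -/
structure EvenClosedWalk (G : SimpleGraph V) where
  q : ℕ
  verts : ℕ → V
  adj : ∀ i, i < 2 * q → G.Adj (verts i) (verts (i + 1))
  closed : verts (2 * q) = verts 0

namespace EvenClosedWalk

variable {G : SimpleGraph V}

/-- The `i`-th edge of the walk, as an element of the edge set of `G`. -/
def edge (w : EvenClosedWalk G) (i : ℕ) (h : i < 2 * w.q) : G.edgeSet :=
  ⟨s(w.verts i, w.verts (i + 1)), w.adj i h⟩

/-- The exponent vector `w⁺` of the monomial `E⁺(w)`, the product of the edges of `w`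
in odd position (`1`-indexed). -/
def plusExp (w : EvenClosedWalk G) : G.edgeSet →₀ ℕ :=
  ∑ k : Fin w.q, Finsupp.single (w.edge (2 * (k : ℕ)) (by have := k.isLt; omega)) 1

/-- The exponent vector `w⁻` of the monomial `E⁻(w)`, the product of the edges of `w`
in even position (`1`-indexed). -/
def minusExp (w : EvenClosedWalk G) : G.edgeSet →₀ ℕ :=
  ∑ k : Fin w.q, Finsupp.single (w.edge (2 * (k : ℕ) + 1) (by have := k.isLt; omega)) 1

end EvenClosedWalk

/-- The monomial `E⁺(w)`. -/
def Eplus (K : Type*) [Field K] {G : SimpleGraph V} (w : EvenClosedWalk G) :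
    MvPolynomial G.edgeSet K :=
  monomial w.plusExp 1

/-- The monomial `E⁻(w)`. -/
def Eminus (K : Type*) [Field K] {G : SimpleGraph V} (w : EvenClosedWalk G) :
    MvPolynomial G.edgeSet K :=
  monomial w.minusExp 1

/-- The binomial `B_w = E⁺(w) - E⁻(w)` of an even closed walk. -/
def Bw (K : Type*) [Field K] {G : SimpleGraph V} (w : EvenClosedWalk G) :
    MvPolynomial G.edgeSet K :=
  binom K w.plusExp w.minusExp

namespace EvenClosedWalk

variable {G : SimpleGraph V}

/-- The number of positions of the walk at which the edge `e` appears. -/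
def count [DecidableEq V] (w : EvenClosedWalk G) (e : Sym2 V) : ℕ :=
  ((Finset.range (2 * w.q)).filter fun i => e = s(w.verts i, w.verts (i + 1))).card

/-- The subgraph `𝐰` of `G` spanned by the edges of the walk `w`. -/
def graph (w : EvenClosedWalk G) : SimpleGraph V :=
  SimpleGraph.fromEdgeSet {e | ∃ i, ∃ _ : i < 2 * w.q, e = s(w.verts i, w.verts (i + 1))}

/-- The set `w⁺` of edges of `w` in odd position (`1`-indexed). -/
def plusEdges (w : EvenClosedWalk G) : Set (Sym2 V) :=
  {e | ∃ k, ∃ _ : k < w.q, e = s(w.verts (2 * k), w.verts (2 * k + 1))}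

/-- The set `w⁻` of edges of `w` in even position (`1`-indexed). -/
def minusEdges (w : EvenClosedWalk G) : Set (Sym2 V) :=
  {e | ∃ k, ∃ _ : k < w.q, e = s(w.verts (2 * k + 1), w.verts (2 * k + 2))}

/-- An even closed walk is primitive if it is nontrivial and there is no even closed
subwalk `ξ` of smaller length with `E⁺(ξ) ∣ E⁺(w)` and `E⁻(ξ) ∣ E⁻(w)`. -/
def IsPrimitive (w : EvenClosedWalk G) : Prop :=
  0 < w.q ∧ ∀ ξ : EvenClosedWalk G, 0 < ξ.q → ξ.q < w.q →
    ¬(ξ.plusExp ≤ w.plusExp ∧ ξ.minusExp ≤ w.minusExp)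

/-- The walk `w` is a cycle: it visits no vertex twice. -/
def IsCycle (w : EvenClosedWalk G) : Prop :=
  2 ≤ w.q ∧ ∀ i j, i < 2 * w.q → j < 2 * w.q → w.verts i = w.verts j → i = j

end EvenClosedWalk

/-! ### Cut vertices, cut edges, blocks, sinks -/

/-- `v` is a cut vertex of `H`: removing `v` (and the edges through it) disconnects two
vertices different from `v` that were connected in `H`. -/
def IsCutVertex (H : SimpleGraph V) (v : V) : Prop :=
  ∃ a b, a ≠ v ∧ b ≠ v ∧ H.Reachable a b ∧
    ¬(SimpleGraph.fromEdgeSet {e | e ∈ H.edgeSet ∧ v ∉ e}).Reachable a b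

/-- `e` is a cut edge of `H`: removing it disconnects two vertices connected in `H`. -/
def IsCutEdge (H : SimpleGraph V) (e : Sym2 V) : Prop :=
  e ∈ H.edgeSet ∧ ∃ a b, H.Reachable a b ∧ ¬(H.deleteEdges {e}).Reachable a b

/-- `H` is biconnected: it has an edge, it is connected (on its support),
and it has no cut vertex. -/
def IsBiconnected (H : SimpleGraph V) : Prop :=
  H.edgeSet.Nonempty ∧ (∀ a ∈ H.support, ∀ b ∈ H.support, H.Reachable a b) ∧
    ∀ v, ¬IsCutVertex H v

/-- `B` is a block of `H`: a maximal biconnected subgraph. -/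
def IsBlock (H B : SimpleGraph V) : Prop :=
  B ≤ H ∧ IsBiconnected B ∧ ∀ B', B ≤ B' → B' ≤ H → IsBiconnected B' → B' = B

/-- A graph is a cycle (graph): its edge set is the edge set of a cycle of length `≥ 3`. -/
def IsCycleGraph (B : SimpleGraph V) : Prop :=
  ∃ (n : ℕ) (f : ℕ → V), 3 ≤ n ∧
    (∀ i j, i < n → j < n → f i = f j → i = j) ∧
    B.edgeSet = {e | ∃ i, ∃ _ : i < n, e = s(f i, f ((i + 1) % n))}

/-- `v` is a sink of the block `B` of the walk `w`: a common vertex of two odd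
(or two even) edges of the walk belonging to `B`. -/
def IsSinkOf {G : SimpleGraph V} (w : EvenClosedWalk G) (B : SimpleGraph V) (v : V) : Prop :=
  ∃ e₁ e₂ : Sym2 V, e₁ ≠ e₂ ∧ e₁ ∈ B.edgeSet ∧ e₂ ∈ B.edgeSet ∧ v ∈ e₁ ∧ v ∈ e₂ ∧
    ((e₁ ∈ w.plusEdges ∧ e₂ ∈ w.plusEdges) ∨ (e₁ ∈ w.minusEdges ∧ e₂ ∈ w.minusEdges))

/-- `B` is a pure cyclic block of the walk `w`: a block of `𝐰` which is a cycle all of whose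
edges lie in `w⁺`, or all in `w⁻`. -/
def IsPureCyclicBlock {G : SimpleGraph V} (w : EvenClosedWalk G) (B : SimpleGraph V) : Prop :=
  IsBlock w.graph B ∧ IsCycleGraph B ∧
    (B.edgeSet ⊆ w.plusEdges ∨ B.edgeSet ⊆ w.minusEdges)

/-- A primitive walk is mixed if it has no pure cyclic block. -/
def EvenClosedWalk.IsMixed {G : SimpleGraph V} (w : EvenClosedWalk G) : Prop :=
  ∀ B : SimpleGraph V, ¬IsPureCyclicBlock w B

lemma support_binom {u v : σ →₀ ℕ} (h : u ≠ v) (w : σ →₀ ℕ) :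
    w ∈ (binom K u v).support ↔ w = u ∨ w = v := by
  classical
  rw [MvPolynomial.mem_support_iff, binom, coeff_sub, coeff_monomial, coeff_monomial]
  by_cases hu : u = w
  · subst hu
    simp [h.symm]
  · by_cases hv : v = w
    · simp [hu, hv]
    · simp [hu, hv, Ne.symm hu, Ne.symm hv]

lemma mem_vars_binom {u v : σ →₀ ℕ} (h : u ≠ v) (i : σ) :
    i ∈ (binom K u v).vars ↔ u i ≠ 0 ∨ v i ≠ 0 := by
  simp [MvPolynomial.mem_vars_iff_mem_support, support_binom h]

lemma binom_ne_zero {u v : σ →₀ ℕ} (h : u ≠ v) : binom K u v ≠ 0 := by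
  rw [← MvPolynomial.support_nonempty]
  exact ⟨u, (support_binom h u).2 (Or.inl rfl)⟩

lemma totalDegree_binom {u v : σ →₀ ℕ} (h : u ≠ v) {q : ℕ} (hu : u.degree = q)
    (hv : v.degree = q) : (binom K u v).totalDegree = q :=
  ((isHomogeneous_monomial 1 hu).sub (isHomogeneous_monomial 1 hv)).totalDegree (binom_ne_zero h)

lemma irreducible_binom {u v : σ →₀ ℕ} {i : σ} (hi : u i = 1) (hd : Disjoint u.support v.support) :
    Irreducible (binom K u v) := by
  classical
  have h : u ≠ v := by
    rintro rfl
    have : u = 0 := by simpa using hd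
    simp [this] at hi
  have hu : u ∈ (binom K u v).support := (support_binom h u).2 (Or.inl rfl)
  have hv : v ∈ (binom K u v).support := (support_binom h v).2 (Or.inr rfl)
  refine irreducible_of_disjoint_support ⟨u, hu, v, hv, h⟩ hu hi ?_ ?_
  · intro a ha b hb hab
    rcases (support_binom h a).1 ha with rfl | rfl <;>
      rcases (support_binom h b).1 hb with rfl | rfl
    · exact absurd rfl hab
    · exact hd
    · exact hd.symm
    · exact absurd rfl hab
  · intro r hr
    have := hr u
    rw [binom, coeff_sub, coeff_monomial, coeff_monomial] at this
    simpa [h.symm] using this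

lemma edgeImage_mk (a b : V) : edgeImage K s(a, b) = X a * X b := rfl

namespace EvenClosedWalk

variable {G : SimpleGraph V}

lemma degree_plusExp (w : EvenClosedWalk G) : w.plusExp.degree = w.q := by
  simp [plusExp, map_sum]

lemma degree_minusExp (w : EvenClosedWalk G) : w.minusExp.degree = w.q := by
  simp [minusExp, map_sum]

lemma plusExp_apply_ne_zero_iff (w : EvenClosedWalk G) (e : G.edgeSet) :
    w.plusExp e ≠ 0 ↔ ∃ k : Fin w.q, (e : Sym2 V) = s(w.verts (2 * k), w.verts (2 * k + 1)) := by
  classical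
  rw [plusExp, Finsupp.finsetSum_apply, Ne, Finset.sum_eq_zero_iff]
  simp [Finsupp.single_apply, edge, Subtype.ext_iff, eq_comm (a := (e : Sym2 V))]

lemma minusExp_apply_ne_zero_iff (w : EvenClosedWalk G) (e : G.edgeSet) :
    w.minusExp e ≠ 0 ↔
      ∃ k : Fin w.q, (e : Sym2 V) = s(w.verts (2 * k + 1), w.verts (2 * k + 2)) := by
  classical
  rw [minusExp, Finsupp.finsetSum_apply, Ne, Finset.sum_eq_zero_iff]
  simp [Finsupp.single_apply, edge, Subtype.ext_iff, eq_comm (a := (e : Sym2 V))]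

lemma plusExp_edge_eq_one (w : EvenClosedWalk G) (k : Fin w.q)
    (h : ∀ l : Fin w.q, s(w.verts (2 * l), w.verts (2 * l + 1)) =
      s(w.verts (2 * k), w.verts (2 * k + 1)) → l = k) :
    w.plusExp (w.edge (2 * k) (by have := k.isLt; omega)) = 1 := by
  classical
  rw [plusExp, Finsupp.finsetSum_apply, Finset.sum_eq_single k]
  · simp
  · intro l _ hl
    rw [Finsupp.single_apply, if_neg]
    intro he
    exact hl (h l (congrArg Subtype.val he))
  · simp

lemma Bw_mem_graphToricIdeal (w : EvenClosedWalk G) : Bw K w ∈ graphToricIdeal K G := by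
  have shift : ∏ k ∈ Finset.range w.q, (X (w.verts (2 * k)) : MvPolynomial V K) =
      ∏ k ∈ Finset.range w.q, X (w.verts (2 * k + 2)) := by
    rcases hq : w.q with _ | q
    · simp
    · have hc := w.closed
      rw [hq] at hc
      rw [Finset.prod_range_succ', Finset.prod_range_succ, Nat.mul_zero, ← hc]
      rfl
  rw [graphToricIdeal, RingHom.mem_ker, Bw, binom, map_sub, sub_eq_zero, plusExp, minusExp,
    monomial_sum_one, monomial_sum_one, map_prod, map_prod]
  change ∏ k : Fin w.q, aeval _ (X _) = ∏ k : Fin w.q, aeval _ (X _)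
  simp only [aeval_X, edge, edgeImage_mk]
  rw [Fin.prod_univ_eq_prod_range (fun k => (X (w.verts (2 * k)) * X (w.verts (2 * k + 1)) :
      MvPolynomial V K)),
    Fin.prod_univ_eq_prod_range (fun k => (X (w.verts (2 * k + 1)) * X (w.verts (2 * k + 2)) :
      MvPolynomial V K)), Finset.prod_mul_distrib, Finset.prod_mul_distrib, shift, mul_comm]

end EvenClosedWalk

lemma sum_incident_eq_of_binom_mem [Fintype V] [DecidableEq V] {G : SimpleGraph V} [Fintype G.edgeSet]
    {u v : G.edgeSet →₀ ℕ} (h : binom K u v ∈ graphToricIdeal K G) (m : V) :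
    (∑ e : G.edgeSet, if m ∈ (e : Sym2 V) then u e else 0) =
      ∑ e : G.edgeSet, if m ∈ (e : Sym2 V) then v e else 0 := by
  let φ : MvPolynomial V K →ₐ[K] Polynomial K :=
    aeval fun x => if m = x then Polynomial.X else 1
  let ψ : MvPolynomial G.edgeSet K →ₐ[K] MvPolynomial V K :=
    aeval fun e => edgeImage K (e : Sym2 V)
  have hφ (e : G.edgeSet) : φ (edgeImage K (e : Sym2 V)) =
      Polynomial.X ^ (if m ∈ (e : Sym2 V) then 1 else 0) := by
    obtain ⟨e, he⟩ := e
    induction e with | _ a b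
    have hab : a ≠ b := G.ne_of_adj he
    simp only [edgeImage_mk, φ, map_mul, aeval_X, Sym2.mem_iff]
    by_cases ha : m = a
    · simp [ha, hab]
    · simp [ha]
  have key (t : G.edgeSet →₀ ℕ) :
      φ (ψ (monomial t 1)) =
        Polynomial.X ^ (∑ e : G.edgeSet, if m ∈ (e : Sym2 V) then t e else 0) := by
    rw [aeval_monomial, Finsupp.prod_fintype _ _ (by simp), map_mul, map_prod]
    simp only [map_one, one_mul, map_pow, hφ, ← pow_mul, ite_mul, zero_mul]
    rw [Finset.prod_pow_eq_pow_sum]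
  rw [graphToricIdeal, RingHom.mem_ker, binom, map_sub, sub_eq_zero] at h
  have h' : ψ (monomial u 1) = ψ (monomial v 1) := h
  have h2 := congrArg φ h'
  rw [key, key] at h2
  have h3 := congrArg Polynomial.natDegree h2
  rwa [Polynomial.natDegree_X_pow, Polynomial.natDegree_X_pow] at h3

lemma exists_edge_weight_of_binom_mem [Fintype V] {G : SimpleGraph V}
    {u v : G.edgeSet →₀ ℕ} (h : binom K u v ∈ graphToricIdeal K G) :
    ∃ d : Sym2 V → ℤ, (∀ e : G.edgeSet, d e = u e - v e) ∧ (∀ e ∉ G.edgeSet, d e = 0) ∧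
      ∀ m, ∑ j, d s(m, j) = 0 := by
  classical
  refine ⟨fun e => if he : e ∈ G.edgeSet then (u ⟨e, he⟩ : ℤ) - v ⟨e, he⟩ else 0,
    fun e => by simp, fun e he => by simp [he], fun m => ?_⟩
  set d : Sym2 V → ℤ := fun e => if he : e ∈ G.edgeSet then (u ⟨e, he⟩ : ℤ) - v ⟨e, he⟩ else 0
  have h1 : ∑ j, d s(m, j) = ∑ e with m ∈ e, d e := by
    rw [← Finset.sum_image (f := d) (g := fun j => s(m, j)) (s := Finset.univ)
      (fun _ _ _ _ hab => Sym2.congr_right.1 hab)]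
    congr 1
    ext e
    simp [Sym2.mem_iff_exists, eq_comm]
  have h2 : ∑ e with m ∈ e, d e = ∑ e : G.edgeSet, if m ∈ (e : Sym2 V) then d e else 0 := by
    rw [Finset.sum_filter]
    refine (Fintype.sum_of_injective _ Subtype.val_injective _ _ (fun e he => ?_)
      fun e => rfl).symm
    have he' : e ∉ G.edgeSet := by simpa using he
    simp [d, he']
  have h3 := congrArg (Nat.cast : ℕ → ℤ) (sum_incident_eq_of_binom_mem h m)
  push_cast at h3
  rw [h1, h2]
  refine Eq.trans ?_ (sub_eq_zero.2 h3)
  rw [← Finset.sum_sub_distrib]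
  refine Finset.sum_congr rfl fun e _ => ?_
  by_cases hm : m ∈ (e : Sym2 V) <;> simp [hm, d]

/-- Adjacency `a ~ b`, for `a < b`, in the graph on `{0, …, n - 1}` which is a 4-cycle if `n = 4`,
and consists of the triangles `{0, 1, 2}` and `{n - 3, n - 2, n - 1}` joined by the path
`2, 3, …, n - 3` if `5 ≤ n`. -/
def DumbbellAdj (n a b : ℕ) : Prop :=
  b < n ∧ (b = a + 1 ∨ (5 ≤ n ∧ (a = 0 ∧ b = 2 ∨ a + 3 = n ∧ b + 1 = n)) ∨ (n = 4 ∧ a = 0 ∧ b = 3))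

lemma dumbbell_weight_eq_zero_iff {n : ℕ} (hn : 4 ≤ n) (D : ℕ → ℕ → ℤ)
    (symm : ∀ a b, D a b = D b a)
    (supp : ∀ a b, ¬ DumbbellAdj n a b → ¬ DumbbellAdj n b a → D a b = 0)
    (sum : ∀ m < n, ∑ j ∈ Finset.range n, D m j = 0) {a b : ℕ} (hab : DumbbellAdj n a b) :
    D a b = 0 ↔ D 0 1 = 0 := by
  unfold DumbbellAdj at supp hab
  obtain rfl | rfl | h6 : n = 4 ∨ n = 5 ∨ 6 ≤ n := by omega
  · have s0 := sum 0 (by omega)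
    have s1 := sum 1 (by omega)
    have s2 := sum 2 (by omega)
    have s3 := sum 3 (by omega)
    simp only [Finset.sum_range_succ, Finset.sum_range_zero] at s0 s1 s2 s3
    have h00 := supp 0 0 (by omega) (by omega)
    have h11 := supp 1 1 (by omega) (by omega)
    have h22 := supp 2 2 (by omega) (by omega)
    have h33 := supp 3 3 (by omega) (by omega)
    have h02 := supp 0 2 (by omega) (by omega)
    have h13 := supp 1 3 (by omega) (by omega)
    have := symm 0 1; have := symm 0 2; have := symm 0 3
    have := symm 1 2; have := symm 1 3; have := symm 2 3
    obtain ⟨rfl, rfl⟩ | ⟨rfl, rfl⟩ | ⟨rfl, rfl⟩ | ⟨rfl, rfl⟩ :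
      (a = 0 ∧ b = 1) ∨ (a = 1 ∧ b = 2) ∨ (a = 2 ∧ b = 3) ∨ (a = 0 ∧ b = 3) := by omega
    all_goals omega
  · have s0 := sum 0 (by omega)
    have s1 := sum 1 (by omega)
    have s2 := sum 2 (by omega)
    have s3 := sum 3 (by omega)
    have s4 := sum 4 (by omega)
    simp only [Finset.sum_range_succ, Finset.sum_range_zero] at s0 s1 s2 s3 s4
    have h00 := supp 0 0 (by omega) (by omega)
    have h11 := supp 1 1 (by omega) (by omega)
    have h22 := supp 2 2 (by omega) (by omega)
    have h33 := supp 3 3 (by omega) (by omega)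
    have h44 := supp 4 4 (by omega) (by omega)
    have h03 := supp 0 3 (by omega) (by omega)
    have h04 := supp 0 4 (by omega) (by omega)
    have h13 := supp 1 3 (by omega) (by omega)
    have h14 := supp 1 4 (by omega) (by omega)
    have := symm 0 1; have := symm 0 2; have := symm 0 3; have := symm 0 4
    have := symm 1 2; have := symm 1 3; have := symm 1 4
    have := symm 2 3; have := symm 2 4; have := symm 3 4
    obtain ⟨rfl, rfl⟩ | ⟨rfl, rfl⟩ | ⟨rfl, rfl⟩ | ⟨rfl, rfl⟩ | ⟨rfl, rfl⟩ | ⟨rfl, rfl⟩ :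
      (a = 0 ∧ b = 1) ∨ (a = 1 ∧ b = 2) ∨ (a = 2 ∧ b = 3) ∨ (a = 3 ∧ b = 4) ∨
        (a = 0 ∧ b = 2) ∨ (a = 2 ∧ b = 4) := by omega
    all_goals omega
  · have edges : ((2 ≤ a ∧ a + 4 ≤ n) ∧ b = a + 1) ∨ (a = 0 ∧ b = 1) ∨ (a = 1 ∧ b = 2) ∨
        (a = 0 ∧ b = 2) ∨ (a = n - 3 ∧ b = n - 2) ∨ (a = n - 3 ∧ b = n - 1) ∨
        (a = n - 2 ∧ b = n - 1) := by
      obtain ⟨hb, rfl | ⟨-, h | h⟩ | h⟩ := hab <;> omega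
    have two (m x y : ℕ) (hm : m < n) (hx : x < n) (hy : y < n) (hxy : x ≠ y)
        (h : ∀ j, j ≠ x → j ≠ y → D m j = 0) : D m x + D m y = 0 := by
      rw [← Finset.sum_pair hxy, ← sum m hm]
      refine Finset.sum_subset (fun j hj => ?_) fun j _ hj => ?_
      · simp only [Finset.mem_insert, Finset.mem_singleton] at hj
        rw [Finset.mem_range]
        omega
      · simp only [Finset.mem_insert, Finset.mem_singleton, not_or] at hj
        exact h j hj.1 hj.2
    have three (m x y z : ℕ) (hm : m < n) (hx : x < n) (hy : y < n) (hz : z < n) (hxy : x ≠ y)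
        (hxz : x ≠ z) (hyz : y ≠ z) (h : ∀ j, j ≠ x → j ≠ y → j ≠ z → D m j = 0) :
        D m x + (D m y + D m z) = 0 := by
      rw [← Finset.sum_pair hyz, ← Finset.sum_insert (by simp [hxy, hxz]), ← sum m hm]
      refine Finset.sum_subset (fun j hj => ?_) fun j _ hj => ?_
      · simp only [Finset.mem_insert, Finset.mem_singleton] at hj
        rw [Finset.mem_range]
        omega
      · simp only [Finset.mem_insert, Finset.mem_singleton, not_or] at hj
        exact h j hj.1 hj.2.1 hj.2.2
    have s0 := two 0 1 2 (by omega) (by omega) (by omega) (by omega)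
      fun j _ _ => supp _ _ (by omega) (by omega)
    have s1 := two 1 0 2 (by omega) (by omega) (by omega) (by omega)
      fun j _ _ => supp _ _ (by omega) (by omega)
    have s2 := three 2 0 1 3 (by omega) (by omega) (by omega) (by omega) (by omega) (by omega)
      (by omega) fun j _ _ _ => supp _ _ (by omega) (by omega)
    have path (k : ℕ) (hk : 3 ≤ k) (hk' : k + 4 ≤ n) : D k (k - 1) + D k (k + 1) = 0 :=
      two k (k - 1) (k + 1) (by omega) (by omega) (by omega) (by omega)
        fun j _ _ => supp _ _ (by omega) (by omega)
    have t0 := three (n - 3) (n - 4) (n - 2) (n - 1) (by omega) (by omega) (by omega) (by omega)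
      (by omega) (by omega) (by omega) fun j _ _ _ => supp _ _ (by omega) (by omega)
    have t1 := two (n - 2) (n - 3) (n - 1) (by omega) (by omega) (by omega) (by omega)
      fun j _ _ => supp _ _ (by omega) (by omega)
    have t2 := two (n - 1) (n - 3) (n - 2) (by omega) (by omega) (by omega) (by omega)
      fun j _ _ => supp _ _ (by omega) (by omega)
    have := symm 0 1; have := symm 0 2; have := symm 1 2
    have := symm (n - 3) (n - 2); have := symm (n - 3) (n - 1); have := symm (n - 2) (n - 1)
    have chain (k : ℕ) (hk : 2 ≤ k) : k + 4 ≤ n → (D k (k + 1) = 0 ↔ D 0 1 = 0) := by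
      induction k, hk using Nat.le_induction with
      | base =>
        intro _
        change D 2 3 = 0 ↔ D 0 1 = 0
        omega
      | succ k hk ih =>
        intro hk'
        have h1 := ih (by omega)
        have h2 := path (k + 1) (by omega) hk'
        rw [Nat.add_sub_cancel, symm (k + 1) k] at h2
        omega
    have last := chain (n - 4) (by omega) (by omega)
    rw [show n - 4 + 1 = n - 3 by omega, symm (n - 4)] at last
    obtain ⟨ha, rfl⟩ | ⟨rfl, rfl⟩ | ⟨rfl, rfl⟩ | ⟨rfl, rfl⟩ | ⟨rfl, rfl⟩ | ⟨rfl, rfl⟩ | ⟨rfl, rfl⟩ :=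
      edges
    · exact chain a ha.1 ha.2
    all_goals omega

/-- The `i`-th vertex of the closed walk
`0, 1, …, n - 1, n - 3, n - 4, …, 2, 0` of length `2 * (n - 2)`. -/
def dumbbellVert (n i : ℕ) : ℕ :=
  if i < n then i else if i < 2 * (n - 2) then 2 * n - 3 - i else 0

lemma dumbbellVert_cases (n i : ℕ) :
    (i < n ∧ dumbbellVert n i = i) ∨
      (n ≤ i ∧ i < 2 * (n - 2) ∧ dumbbellVert n i = 2 * n - 3 - i) ∨
      (n ≤ i ∧ 2 * (n - 2) ≤ i ∧ dumbbellVert n i = 0) := by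
  unfold dumbbellVert
  split_ifs <;> omega

lemma dumbbellVert_lt {n : ℕ} (hn : 4 ≤ n) (i : ℕ) : dumbbellVert n i < n := by
  have := dumbbellVert_cases n i
  omega

lemma dumbbellAdj_dumbbellVert {n : ℕ} (hn : 4 ≤ n) {i : ℕ} (hi : i < 2 * (n - 2)) :
    DumbbellAdj n (dumbbellVert n i) (dumbbellVert n (i + 1)) ∨
      DumbbellAdj n (dumbbellVert n (i + 1)) (dumbbellVert n i) := by
  unfold DumbbellAdj
  rcases dumbbellVert_cases n i with ⟨h1, h⟩ | ⟨h1, h2, h⟩ | ⟨h1, h2, h⟩ <;>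
    rcases dumbbellVert_cases n (i + 1) with ⟨h1', h'⟩ | ⟨h1', h2', h'⟩ | ⟨h1', h2', h'⟩ <;>
    rw [h, h'] <;> clear h h'
  · left; omega
  all_goals right; omega

lemma DumbbellAdj.ne {n a b : ℕ} (h : DumbbellAdj n a b) : a ≠ b := by
  unfold DumbbellAdj at h
  omega

/-- The dumbbell walk as an even closed walk in the complete graph. -/
def dumbbellWalk (n : ℕ) (hn : 4 ≤ n) : EvenClosedWalk (⊤ : SimpleGraph (Fin n)) where
  q := n - 2
  verts i := ⟨dumbbellVert n i, dumbbellVert_lt hn i⟩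
  adj i hi := by
    rw [SimpleGraph.top_adj, Ne, Fin.mk.injEq]
    rcases dumbbellAdj_dumbbellVert hn hi with h | h
    · exact h.ne
    · exact h.ne.symm
  closed := by
    have := dumbbellVert_cases n (2 * (n - 2))
    have := dumbbellVert_cases n 0
    rw [Fin.mk.injEq]
    omega

lemma dumbbellWalk_plus_ne_minus {n : ℕ} (hn : 4 ≤ n) {k l : ℕ} (hk : k < n - 2) (hl : l < n - 2) :
    s((dumbbellWalk n hn).verts (2 * k), (dumbbellWalk n hn).verts (2 * k + 1)) ≠
      s((dumbbellWalk n hn).verts (2 * l + 1), (dumbbellWalk n hn).verts (2 * l + 2)) := by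
  have := dumbbellVert_cases n (2 * k)
  have := dumbbellVert_cases n (2 * k + 1)
  have := dumbbellVert_cases n (2 * l + 1)
  have := dumbbellVert_cases n (2 * l + 2)
  simp only [dumbbellWalk, Ne, Sym2.eq_iff, Fin.mk.injEq]
  omega

lemma dumbbellWalk_first_edge_unique {n : ℕ} (hn : 4 ≤ n) {l : ℕ} (hl : l < n - 2)
    (h : s((dumbbellWalk n hn).verts (2 * l), (dumbbellWalk n hn).verts (2 * l + 1)) =
      s((dumbbellWalk n hn).verts (2 * 0), (dumbbellWalk n hn).verts (2 * 0 + 1))) : l = 0 := by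
  have := dumbbellVert_cases n (2 * l)
  have := dumbbellVert_cases n (2 * l + 1)
  have := dumbbellVert_cases n (2 * 0)
  have := dumbbellVert_cases n (2 * 0 + 1)
  simp only [dumbbellWalk, Sym2.eq_iff, Fin.mk.injEq] at h
  omega

lemma dumbbellWalk_weight_eq_zero {n : ℕ} (hn : 4 ≤ n) (d : Sym2 (Fin n) → ℤ)
    (supp : ∀ e, (∀ i < 2 * (n - 2),
      e ≠ s((dumbbellWalk n hn).verts i, (dumbbellWalk n hn).verts (i + 1))) → d e = 0)
    (sum : ∀ m, ∑ j, d s(m, j) = 0) {i : ℕ} (hi : i < 2 * (n - 2))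
    (h : d s((dumbbellWalk n hn).verts i, (dumbbellWalk n hn).verts (i + 1)) = 0) :
    d = 0 := by
  let D : ℕ → ℕ → ℤ := fun a b => if h : a < n ∧ b < n then d s(⟨a, h.1⟩, ⟨b, h.2⟩) else 0
  have hD (a b : Fin n) : D a b = d s(a, b) := by simp [D]
  have symm (a b : ℕ) : D a b = D b a := by
    simp only [D, and_comm (a := a < n)]
    split_ifs
    · rw [Sym2.eq_swap]
    · rfl
  have key {a b : ℕ} := dumbbell_weight_eq_zero_iff hn D symm (a := a) (b := b)
    (fun a b h1 h2 => by
      by_cases hab : a < n ∧ b < n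
      · simp only [D, dif_pos hab]
        refine supp _ fun i hi he => ?_
        have := dumbbellAdj_dumbbellVert hn hi
        simp only [dumbbellWalk, Sym2.eq_iff, Fin.mk.injEq] at he
        rcases he with ⟨rfl, rfl⟩ | ⟨rfl, rfl⟩ <;> tauto
      · simp only [D, dif_neg hab])
    (fun m hm => by
      rw [Finset.sum_range]
      exact (Finset.sum_congr rfl fun j _ => hD ⟨m, hm⟩ j).trans (sum ⟨m, hm⟩))
  have edge {i : ℕ} (hi : i < 2 * (n - 2)) :
      d s((dumbbellWalk n hn).verts i, (dumbbellWalk n hn).verts (i + 1)) = 0 ↔ D 0 1 = 0 := by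
    rw [← hD]
    rcases dumbbellAdj_dumbbellVert hn hi with h | h
    · exact key h
    · rw [symm]
      exact key h
  ext e
  by_cases he : ∃ i < 2 * (n - 2),
      e = s((dumbbellWalk n hn).verts i, (dumbbellWalk n hn).verts (i + 1))
  · obtain ⟨j, hj, rfl⟩ := he
    exact (edge hj).2 ((edge hi).1 h)
  · push Not at he
    exact supp e he

namespace EvenClosedWalk

variable {G : SimpleGraph V}

lemma plusExp_ne_zero_or_minusExp_ne_zero_iff (w : EvenClosedWalk G) (e : G.edgeSet) :
    (w.plusExp e ≠ 0 ∨ w.minusExp e ≠ 0) ↔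
      ∃ i < 2 * w.q, (e : Sym2 V) = s(w.verts i, w.verts (i + 1)) := by
  rw [plusExp_apply_ne_zero_iff, minusExp_apply_ne_zero_iff]
  constructor
  · rintro (⟨k, hk⟩ | ⟨k, hk⟩)
    · exact ⟨2 * k, by omega, hk⟩
    · exact ⟨2 * k + 1, by omega, hk⟩
  · rintro ⟨i, hi, he⟩
    obtain ⟨k, rfl | rfl⟩ := Nat.even_or_odd' i
    · exact Or.inl ⟨⟨k, by omega⟩, he⟩
    · exact Or.inr ⟨⟨k, by omega⟩, he⟩

/-- If the positive and the negative edges of a walk are disjoint, some positive edge is traversed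
only once, and every nonzero balanced edge weighting supported on the walk is nowhere zero on it,
then the binomial of the walk is a circuit. -/
lemma isCircuitBinomial_Bw [Fintype V] (w : EvenClosedWalk G)
    (disj : ∀ k < w.q, ∀ l < w.q, s(w.verts (2 * k), w.verts (2 * k + 1)) ≠
      s(w.verts (2 * l + 1), w.verts (2 * l + 2)))
    (k : Fin w.q) (hk : ∀ l : Fin w.q, s(w.verts (2 * l), w.verts (2 * l + 1)) =
      s(w.verts (2 * k), w.verts (2 * k + 1)) → l = k)
    (rigid : ∀ d : Sym2 V → ℤ,
      (∀ e, (∀ i < 2 * w.q, e ≠ s(w.verts i, w.verts (i + 1))) → d e = 0) →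
      (∀ m, ∑ j, d s(m, j) = 0) → ∀ i < 2 * w.q, d s(w.verts i, w.verts (i + 1)) = 0 → d = 0) :
    w.plusExp ≠ w.minusExp ∧ IsCircuitBinomial (graphToricIdeal K G) (Bw K w) := by
  have hk1 := w.plusExp_edge_eq_one k hk
  have hdisj : Disjoint w.plusExp.support w.minusExp.support := by
    rw [Finset.disjoint_left]
    intro e he he'
    rw [Finsupp.mem_support_iff, plusExp_apply_ne_zero_iff] at he
    rw [Finsupp.mem_support_iff, minusExp_apply_ne_zero_iff] at he'
    obtain ⟨a, ha⟩ := he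
    obtain ⟨b, hb⟩ := he'
    exact disj a a.2 b b.2 (ha.symm.trans hb)
  have hne : w.plusExp ≠ w.minusExp := by
    intro h
    rw [← h, disjoint_self, Finset.bot_eq_empty, Finsupp.support_eq_empty] at hdisj
    simp [hdisj] at hk1
  refine ⟨hne, ⟨_, _, hne, rfl⟩, w.Bw_mem_graphToricIdeal, irreducible_binom hk1 hdisj, ?_⟩
  rintro _ ⟨u, v, huv, rfl⟩ hmem hsub
  refine hsub.antisymm fun e he => ?_
  obtain ⟨d, hd, hd0, hsum⟩ := exists_edge_weight_of_binom_mem hmem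
  rw [Bw, mem_vars_binom hne, plusExp_ne_zero_or_minusExp_ne_zero_iff] at he
  rw [mem_vars_binom huv]
  by_contra hcon
  push Not at hcon
  obtain ⟨i, hi, hei⟩ := he
  have hzero : d = 0 := by
    refine rigid d (fun e' he' => ?_) hsum i hi ?_
    · by_cases hG : e' ∈ G.edgeSet
      · by_contra hne0
        have hvar : (⟨e', hG⟩ : G.edgeSet) ∈ (binom K u v).vars := by
          rw [mem_vars_binom huv]
          have := hd ⟨e', hG⟩
          by_contra h0
          push Not at h0
          simp [h0] at this
          exact hne0 this
        have := hsub hvar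
        rw [Bw, mem_vars_binom hne, plusExp_ne_zero_or_minusExp_ne_zero_iff] at this
        obtain ⟨j, hj, hej⟩ := this
        exact he' j hj hej
      · exact hd0 e' hG
    · rw [← hei, hd, hcon.1, hcon.2]
      simp
  refine huv (Finsupp.ext fun e' => ?_)
  have := hd e'
  rw [hzero, Pi.zero_apply] at this
  omega

end EvenClosedWalk

/-- For every `n ≥ 4`, the toric ideal `I_{K_n}` contains a circuit of
degree `n - 2`. -/
theorem exists_circuit_of_degree_completeGraph (K : Type*) [Field K] (n : ℕ) (hn : 4 ≤ n) :
    ∃ f, IsCircuitBinomial (graphToricIdeal K (⊤ : SimpleGraph (Fin n))) f ∧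
      f.totalDegree = n - 2 := by
  obtain ⟨hne, hcircuit⟩ := (dumbbellWalk n hn).isCircuitBinomial_Bw (K := K)
    (fun k hk l hl => dumbbellWalk_plus_ne_minus hn hk hl) ⟨0, by change 0 < n - 2; omega⟩
    (fun l hl => Fin.ext (dumbbellWalk_first_edge_unique hn l.2 hl))
    (fun d hsupp hsum i hi => dumbbellWalk_weight_eq_zero hn d hsupp hsum hi)
  exact ⟨_, hcircuit, totalDegree_binom hne (dumbbellWalk n hn).degree_plusExp
    (dumbbellWalk n hn).degree_minusExp⟩

end
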